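/- Let 1 < α ≤ 2 and let λ ∈ ℝ satisfy E_α(−λ) + (1−λ) E_{α,α}(−λ) + E_{α,α−1}(−λ) = 0. Define y(t) = t^{α−1} E_{α,α}(−λ t^α) + t^{α−2} E_{α,α−1}(−λ t^α) for t ∈ (0,1]. Then y satisfies D^α_0 y(t) + λ y(t) = 0 for all t ∈ (0,1), together with the boundary conditions lim_{t→0⁺} (I^{2−α}_0 y(t) − D^{α−1}_0 y(t)) = 0 and y(1) + D^{α−1}_0 y(1) = 0; that is, λ is an eigenvalue of the Robin fractional boundary value problem on (0,1) with eigenfunction y. -/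

import Mathlib

open Real Set Filter MeasureTheory

/-- Riemann–Liouville fractional integral of order `ν` based at `a`
(`I^0_a` is the identity). -/
noncomputable def RLint (a ν : ℝ) (y : ℝ → ℝ) (t : ℝ) : ℝ :=
  if ν = 0 then y t
  else (1 / Real.Gamma ν) * ∫ s in a..t, (t - s) ^ (ν - 1) * y s

/-- Riemann–Liouville fractional derivative of order `α` with `1 < α ≤ 2`:
`D^α_a y = (d²/dt²) I^{2-α}_a y`. -/
noncomputable def RLderivHigh (a α : ℝ) (y : ℝ → ℝ) (t : ℝ) : ℝ :=
  deriv (deriv (RLint a (2 - α) y)) t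

/-- Riemann–Liouville fractional derivative of order `β` with `0 < β ≤ 1`:
`D^β_a y = (d/dt) I^{1-β}_a y`. -/
noncomputable def RLderivLow (a β : ℝ) (y : ℝ → ℝ) (t : ℝ) : ℝ :=
  deriv (RLint a (1 - β) y) t

/-- The Green's function for the Robin fractional boundary value problem. -/
noncomputable def greenG (a b α t s : ℝ) : ℝ :=
  if t ≤ s then
    ((t - a) ^ (α - 1) + (α - 1) * (t - a) ^ (α - 2)) /
        ((b - a) ^ (α - 1) + (α - 1) * (b - a) ^ (α - 2) + Real.Gamma α) *
      ((b - s) ^ (α - 1) / Real.Gamma α + 1)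
  else
    ((t - a) ^ (α - 1) + (α - 1) * (t - a) ^ (α - 2)) /
        ((b - a) ^ (α - 1) + (α - 1) * (b - a) ^ (α - 2) + Real.Gamma α) *
      ((b - s) ^ (α - 1) / Real.Gamma α + 1) -
      (t - s) ^ (α - 1) / Real.Gamma α

/-- The two-parameter Mittag-Leffler function `E_{α,β}(x) = ∑ x^k / Γ(kα+β)`. -/
noncomputable def ML (α β x : ℝ) : ℝ := ∑' k : ℕ, x ^ k / Real.Gamma (k * α + β)

lemma ml_summable (α β x : ℝ) (hα : 1 < α) (hβ : 0 < β) :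
    Summable (fun k : ℕ => x ^ k / Real.Gamma (k * α + β)) := by
  refine summable_of_ratio_norm_eventually_le (r := 1 / 2) (by norm_num) ?_
  have h1 : ∀ᶠ k : ℕ in atTop, (2 * |x| + 1 : ℝ) ≤ k := tendsto_natCast_atTop_atTop.eventually_ge_atTop _
  filter_upwards [h1] with k hk
  have hx := abs_nonneg x
  have hk0 : (0 : ℝ) ≤ k := Nat.cast_nonneg k
  have hka : (k : ℝ) ≤ k * α := by nlinarith
  set z : ℝ := k * α + β with hz
  have hz1 : 2 * |x| + 1 ≤ z := by linarith
  have hz0 : 0 < z := by linarith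
  have e : ((k + 1 : ℕ) : ℝ) * α + β = z + α := by push_cast; ring
  have hG : z * Real.Gamma z ≤ Real.Gamma (z + α) := by
    rw [← Real.Gamma_add_one hz0.ne']
    exact Real.Gamma_strictMonoOn_Ici.monotoneOn (by simp; linarith) (by simp; linarith) (by linarith)
  have hG0 : 0 < Real.Gamma z := Real.Gamma_pos_of_pos hz0
  have hG1 : 0 < Real.Gamma (z + α) := Real.Gamma_pos_of_pos (by linarith)
  rw [e, norm_div, norm_div, norm_pow, norm_pow, Real.norm_eq_abs, Real.norm_of_nonneg hG0.le,
    Real.norm_of_nonneg hG1.le, pow_succ, ← mul_div_assoc, div_le_div_iff₀ hG1 hG0]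
  have : |x| * Real.Gamma z ≤ 1 / 2 * Real.Gamma (z + α) := by nlinarith
  calc |x| ^ k * |x| * Real.Gamma z = |x| ^ k * (|x| * Real.Gamma z) := by ring
    _ ≤ |x| ^ k * (1 / 2 * Real.Gamma (z + α)) := by gcongr
    _ = _ := by ring

/-- The series `∑ c^k t^(kα+β-1) / Γ(kα+β)`. -/
noncomputable def PS (α c β t : ℝ) : ℝ :=
  ∑' k : ℕ, c ^ k * (t ^ ((k : ℝ) * α + β - 1) / Real.Gamma (k * α + β))

lemma PS_term (α c β t : ℝ) (ht : 0 < t) (k : ℕ) :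
    c ^ k * (t ^ ((k : ℝ) * α + β - 1) / Real.Gamma (k * α + β)) =
      t ^ (β - 1) * ((c * t ^ α) ^ k / Real.Gamma (k * α + β)) := by
  have : t ^ ((k : ℝ) * α + β - 1) = t ^ (β - 1) * (t ^ α) ^ k := by
    rw [← Real.rpow_mul_natCast ht.le, ← Real.rpow_add ht]; congr 1; ring
  rw [this, mul_pow]; ring

lemma PS_eq_ML (α c β t : ℝ) (ht : 0 < t) :
    PS α c β t = t ^ (β - 1) * ML α β (c * t ^ α) := by
  unfold PS ML
  rw [← tsum_mul_left]
  exact tsum_congr fun k => PS_term α c β t ht k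

lemma PS_summable (α c β t : ℝ) (hα : 1 < α) (hβ : 0 < β) (ht : 0 < t) :
    Summable (fun k : ℕ => c ^ k * (t ^ ((k : ℝ) * α + β - 1) / Real.Gamma (k * α + β))) := by
  simp_rw [PS_term α c β t ht]
  exact (ml_summable α β _ hα hβ).mul_left _

lemma PS_split (α c β t : ℝ) (hα : 1 < α) (hβ : 0 < β) (ht : 0 < t) :
    PS α c β t = t ^ (β - 1) / Real.Gamma β + c * PS α c (β + α) t := by
  unfold PS
  rw [(PS_summable α c β t hα hβ ht).tsum_eq_zero_add, ← tsum_mul_left]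
  congr 1
  · simp
  · refine tsum_congr fun k => ?_
    have e1 : ((k + 1 : ℕ) : ℝ) * α + β = k * α + (β + α) := by push_cast; ring
    rw [e1, pow_succ]; ring

lemma rpow_div_Gamma_hasDerivAt (p t : ℝ) (hp : 1 < p) (ht : 0 < t) :
    HasDerivAt (fun s : ℝ => s ^ (p - 1) / Real.Gamma p)
      (t ^ (p - 2) / Real.Gamma (p - 1)) t := by
  have h := (Real.hasDerivAt_rpow_const (x := t) (p := p - 1) (Or.inl ht.ne')).div_const (Real.Gamma p)
  refine h.congr_deriv ?_
  have hG : Real.Gamma p = (p - 1) * Real.Gamma (p - 1) := by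
    rw [← Real.Gamma_add_one (by linarith)]; congr 1; ring
  have : Real.Gamma (p - 1) ≠ 0 := (Real.Gamma_pos_of_pos (by linarith)).ne'
  have : p - 1 ≠ 0 := by linarith
  rw [hG, show p - 1 - 1 = p - 2 by ring]
  field_simp

lemma PS_hasDerivAt (α c β t : ℝ) (hα : 1 < α) (hβ : 2 ≤ β) (ht : 0 < t) :
    HasDerivAt (PS α c β) (PS α c (β - 1) t) t := by
  have hmem : t ∈ Ioo 0 (t + 1) := ⟨ht, by linarith⟩
  have key := hasDerivAt_tsum_of_isPreconnected
    (g := fun (k : ℕ) (s : ℝ) => c ^ k * (s ^ ((k : ℝ) * α + β - 1) / Real.Gamma (k * α + β)))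
    (g' := fun (k : ℕ) (s : ℝ) => c ^ k * (s ^ ((k : ℝ) * α + (β - 1) - 1) / Real.Gamma (k * α + (β - 1))))
    (u := fun k : ℕ => |c| ^ k * ((t + 1) ^ ((k : ℝ) * α + (β - 1) - 1) / Real.Gamma (k * α + (β - 1))))
    (t := Ioo 0 (t + 1)) (y₀ := t) (y := t)
    (PS_summable α |c| (β - 1) (t + 1) hα (by linarith) (by linarith)) isOpen_Ioo isPreconnected_Ioo
    ?_ ?_ hmem (PS_summable α c β t hα (by linarith) ht) hmem
  · exact key
  · intro k s hs
    have hk : (0 : ℝ) ≤ k * α := by positivity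
    have h := (rpow_div_Gamma_hasDerivAt (k * α + β) s (by linarith) hs.1).const_mul (c ^ k)
    refine h.congr_deriv ?_
    rw [show (k : ℝ) * α + (β - 1) - 1 = k * α + β - 2 by ring,
      show (k : ℝ) * α + (β - 1) = k * α + β - 1 by ring]
  · intro k s hs
    have hk : (0 : ℝ) ≤ k * α := by positivity
    have hG : 0 < Real.Gamma (k * α + (β - 1)) := Real.Gamma_pos_of_pos (by linarith)
    rw [norm_mul, norm_pow, norm_div, Real.norm_eq_abs, Real.norm_of_nonneg hG.le,
      Real.norm_of_nonneg (Real.rpow_nonneg hs.1.le _)]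
    gcongr
    · exact hs.1.le
    · linarith
    · exact hs.2.le

lemma PS_tendsto (α c β : ℝ) (hα : 1 < α) (hβ : 1 < β) :
    Tendsto (PS α c β) (nhdsWithin 0 (Ioi 0)) (nhds 0) := by
  have hlim : Tendsto (fun t : ℝ => t ^ (β - 1) * ML α β |c|) (nhdsWithin 0 (Ioi 0)) (nhds 0) := by
    have : Tendsto (fun t : ℝ => t ^ (β - 1)) (nhdsWithin 0 (Ioi 0)) (nhds 0) := by
      have h := (Real.continuousAt_rpow_const 0 (β - 1) (Or.inr (by linarith))).tendsto
      rw [Real.zero_rpow (by linarith)] at h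
      exact h.mono_left nhdsWithin_le_nhds
    simpa using this.mul_const (ML α β |c|)
  refine squeeze_zero_norm' ?_ hlim
  filter_upwards [Ioo_mem_nhdsGT (zero_lt_one' ℝ)] with t ht
  rw [PS_eq_ML _ _ _ _ ht.1, norm_mul, Real.norm_of_nonneg (Real.rpow_nonneg ht.1.le _)]
  refine mul_le_mul_of_nonneg_left ?_ (Real.rpow_nonneg ht.1.le _)
  refine tsum_of_norm_bounded (ml_summable α β |c| hα (by linarith)).hasSum fun k => ?_
  have hG : 0 < Real.Gamma (k * α + β) := Real.Gamma_pos_of_pos (by positivity)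
  rw [norm_div, norm_pow, norm_mul, Real.norm_eq_abs, Real.norm_of_nonneg hG.le,
    Real.norm_of_nonneg (Real.rpow_nonneg ht.1.le _)]
  have : t ^ α ≤ 1 := Real.rpow_le_one ht.1.le ht.2.le (by linarith)
  have h0 : 0 ≤ t ^ α := Real.rpow_nonneg ht.1.le _
  gcongr
  exact mul_le_of_le_one_right (abs_nonneg _) this

lemma beta_real (b ν t : ℝ) (hb : 0 < b) (hν : 0 < ν) (ht : 0 < t) :
    ∫ s in (0:ℝ)..t, (t - s) ^ (ν - 1) * (s ^ (b - 1) / Real.Gamma b) =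
      Real.Gamma ν * (t ^ (b + ν - 1) / Real.Gamma (b + ν)) := by
  have h := Complex.betaIntegral_scaled (b : ℂ) (ν : ℂ) ht
  rw [Complex.betaIntegral_eq_Gamma_mul_div _ _ (by simpa) (by simpa)] at h
  have h2 : ∫ x in (0:ℝ)..t, (x : ℂ) ^ ((b : ℂ) - 1) * ((t : ℂ) - x) ^ ((ν : ℂ) - 1) =
      ((∫ s in (0:ℝ)..t, s ^ (b - 1) * (t - s) ^ (ν - 1) : ℝ) : ℂ) := by
    rw [← intervalIntegral.integral_ofReal]
    refine intervalIntegral.integral_congr fun x hx => ?_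
    rw [uIcc_of_le ht.le] at hx
    rw [Complex.ofReal_mul, Complex.ofReal_cpow hx.1, Complex.ofReal_cpow (by linarith [hx.2])]
    push_cast; rfl
  have h3 : (t : ℂ) ^ ((b : ℂ) + ν - 1) = ((t ^ (b + ν - 1) : ℝ) : ℂ) := by
    rw [Complex.ofReal_cpow ht.le]; push_cast; rfl
  rw [h2, h3, ← Complex.ofReal_add, Complex.Gamma_ofReal, Complex.Gamma_ofReal, Complex.Gamma_ofReal] at h
  have h4 : ∫ s in (0:ℝ)..t, s ^ (b - 1) * (t - s) ^ (ν - 1) =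
    t ^ (b + ν - 1) * (Real.Gamma b * Real.Gamma ν / Real.Gamma (b + ν)) := by exact_mod_cast h
  have : Real.Gamma b ≠ 0 := (Real.Gamma_pos_of_pos hb).ne'
  have h5 : ∀ s : ℝ, (t - s) ^ (ν - 1) * (s ^ (b - 1) / Real.Gamma b) =
    (Real.Gamma b)⁻¹ * (s ^ (b - 1) * (t - s) ^ (ν - 1)) := fun s => by field_simp
  simp_rw [h5]
  rw [intervalIntegral.integral_const_mul, h4]
  field_simp

lemma frac_series {ι : Type} [Countable ι] (a b : ι → ℝ) (ν t : ℝ) (hb : ∀ i, 0 < b i)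
    (hν : 0 < ν) (ht : 0 < t)
    (hs : Summable fun i => |a i| * (t ^ (b i + ν - 1) / Real.Gamma (b i + ν))) :
    (1 / Real.Gamma ν) * ∫ s in (0:ℝ)..t,
        (t - s) ^ (ν - 1) * ∑' i, a i * (s ^ (b i - 1) / Real.Gamma (b i)) =
      ∑' i, a i * (t ^ (b i + ν - 1) / Real.Gamma (b i + ν)) := by
  have hGν : 0 < Real.Gamma ν := Real.Gamma_pos_of_pos hν
  have hbase : ∀ i, IntervalIntegrable
      (fun s : ℝ => (t - s) ^ (ν - 1) * (s ^ (b i - 1) / Real.Gamma (b i))) volume 0 t := by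
    intro i
    apply intervalIntegral.intervalIntegrable_of_integral_ne_zero
    rw [beta_real _ _ _ (hb i) hν ht]
    have : 0 < Real.Gamma (b i + ν) := Real.Gamma_pos_of_pos (by linarith [hb i])
    have := Real.rpow_pos_of_pos ht (b i + ν - 1)
    positivity
  let F : ι → ℝ → ℝ := fun i s => a i * ((t - s) ^ (ν - 1) * (s ^ (b i - 1) / Real.Gamma (b i)))
  have hF : ∀ i, Integrable (F i) (volume.restrict (Ioc 0 t)) := fun i =>
    ((intervalIntegrable_iff_integrableOn_Ioc_of_le ht.le).1 (hbase i)).const_mul (a i)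
  have hbeta : ∀ i, ∫ s in Ioc 0 t, (t - s) ^ (ν - 1) * (s ^ (b i - 1) / Real.Gamma (b i)) =
      Real.Gamma ν * (t ^ (b i + ν - 1) / Real.Gamma (b i + ν)) := fun i => by
    rw [← intervalIntegral.integral_of_le ht.le, beta_real _ _ _ (hb i) hν ht]
  have hFn : ∀ i, ∫ s in Ioc 0 t, ‖F i s‖ =
      Real.Gamma ν * (|a i| * (t ^ (b i + ν - 1) / Real.Gamma (b i + ν))) := by
    intro i
    have : ∫ s in Ioc 0 t, ‖F i s‖ =
        ∫ s in Ioc 0 t, |a i| * ((t - s) ^ (ν - 1) * (s ^ (b i - 1) / Real.Gamma (b i))) := by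
      refine setIntegral_congr_fun measurableSet_Ioc fun s hs => ?_
      have h1 : 0 ≤ (t - s) ^ (ν - 1) := Real.rpow_nonneg (by linarith [hs.2]) _
      have h2 : 0 ≤ s ^ (b i - 1) := Real.rpow_nonneg hs.1.le _
      have h3 : 0 < Real.Gamma (b i) := Real.Gamma_pos_of_pos (hb i)
      simp only [F]
      rw [norm_mul, Real.norm_eq_abs, Real.norm_of_nonneg (by positivity)]
    rw [this, integral_const_mul, hbeta]; ring
  have key := (hasSum_integral_of_summable_integral_norm hF
    (by simp_rw [hFn]; exact hs.mul_left _)).tsum_eq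
  have e1 : ∀ s : ℝ, (t - s) ^ (ν - 1) * ∑' i, a i * (s ^ (b i - 1) / Real.Gamma (b i)) =
      ∑' i, F i s := by
    intro s
    rw [← tsum_mul_left]
    refine tsum_congr fun i => ?_
    simp only [F]; ring
  simp_rw [e1]
  rw [intervalIntegral.integral_of_le ht.le, ← key, ← tsum_mul_left]
  refine tsum_congr fun i => ?_
  simp only [F]
  rw [integral_const_mul, hbeta]
  field_simp

lemma frac_PS (α c ν t β γ : ℝ) (hα : 1 < α) (hβ : 0 < β) (hγ : 0 < γ) (hν : 0 < ν) (ht : 0 < t) :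
    (1 / Real.Gamma ν) * ∫ s in (0:ℝ)..t, (t - s) ^ (ν - 1) * (PS α c β s + PS α c γ s) =
      PS α c (β + ν) t + PS α c (γ + ν) t := by
  have e : ∀ (x : ℝ) (k : ℕ), (k : ℝ) * α + (x + ν) = k * α + x + ν := fun x k => by ring
  let a : ℕ ⊕ ℕ → ℝ := Sum.elim (fun k => c ^ k) (fun k => c ^ k)
  let b : ℕ ⊕ ℕ → ℝ := Sum.elim (fun k => k * α + β) (fun k => k * α + γ)
  have hb : ∀ i, 0 < b i := by
    rintro (k | k) <;> simp only [b, Sum.elim_inl, Sum.elim_inr] <;> positivity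
  have s1 : ∀ d x : ℝ, 0 < x → Summable fun k : ℕ =>
      d ^ k * (t ^ ((k : ℝ) * α + x + ν - 1) / Real.Gamma (k * α + x + ν)) := fun d x hx => by
    have := PS_summable α d (x + ν) t hα (by linarith) ht
    simpa only [e] using this
  have key := frac_series a b ν t hb hν ht ?_
  · have t1 := Summable.tsum_sum
      (f := fun i => a i * (t ^ (b i + ν - 1) / Real.Gamma (b i + ν))) (s1 c β hβ) (s1 c γ hγ)
    rw [t1] at key
    have hPS : ∀ x : ℝ, PS α c (x + ν) t = ∑' k : ℕ,
      c ^ k * (t ^ ((k : ℝ) * α + x + ν - 1) / Real.Gamma (k * α + x + ν)) := fun x => by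
        unfold PS; simp only [e]
    rw [hPS, hPS]
    refine Eq.trans ?_ key
    congr 1
    rw [intervalIntegral.integral_of_le ht.le, intervalIntegral.integral_of_le ht.le]
    refine setIntegral_congr_fun measurableSet_Ioc fun s hs => ?_
    have t2 := Summable.tsum_sum (f := fun i => a i * (s ^ (b i - 1) / Real.Gamma (b i)))
      (PS_summable α c β s hα hβ hs.1) (PS_summable α c γ s hα hγ hs.1)
    exact congrArg (fun z => (t - s) ^ (ν - 1) * z) t2.symm
  · have s2 : ∀ x : ℝ, 0 < x → Summable fun k : ℕ =>
        |c ^ k| * (t ^ ((k : ℝ) * α + x + ν - 1) / Real.Gamma (k * α + x + ν)) := fun x hx => by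
      simpa only [abs_pow] using s1 |c| x hx
    exact Summable.sum _ (s2 β hβ) (s2 γ hγ)

theorem stmt19 (α lam : ℝ) (hα1 : 1 < α) (hα2 : α ≤ 2)
    (heig : ML α 1 (-lam) + (1 - lam) * ML α α (-lam) + ML α (α - 1) (-lam) = 0)
    (y : ℝ → ℝ)
    (hy : ∀ t, y t = t ^ (α - 1) * ML α α (-lam * t ^ α) +
      t ^ (α - 2) * ML α (α - 1) (-lam * t ^ α)) :
    (∀ t ∈ Set.Ioo (0 : ℝ) 1, RLderivHigh 0 α y t + lam * y t = 0) ∧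
    Filter.Tendsto (fun t => RLint 0 (2 - α) y t - RLderivLow 0 (α - 1) y t)
      (nhdsWithin 0 (Set.Ioi 0)) (nhds 0) ∧
    y 1 + RLderivLow 0 (α - 1) y 1 = 0 := by
  have hyP : ∀ t, 0 < t → y t = PS α (-lam) α t + PS α (-lam) (α - 1) t := fun t ht => by
    rw [hy, PS_eq_ML _ _ _ _ ht, PS_eq_ML _ _ _ _ ht, show α - 1 - 1 = α - 2 by ring]
  have hI : ∀ t, 0 < t → RLint 0 (2 - α) y t = PS α (-lam) 2 t + PS α (-lam) 1 t := by
    intro t ht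
    unfold RLint
    split_ifs with h
    · have : α = 2 := by linarith
      subst this
      rw [hyP t ht]; norm_num
    · have hν : 0 < 2 - α := lt_of_le_of_ne (by linarith) (Ne.symm h)
      have key := frac_PS α (-lam) (2 - α) t α (α - 1) hα1 (by linarith) (by linarith) hν ht
      rw [show α + (2 - α) = 2 by ring, show α - 1 + (2 - α) = 1 by ring] at key
      rw [← key]
      congr 1
      rw [intervalIntegral.integral_of_le ht.le, intervalIntegral.integral_of_le ht.le]
      refine setIntegral_congr_fun measurableSet_Ioc fun s hs => ?_
      rw [hyP s hs.1]
  have hd1 : ∀ t, 0 < t → HasDerivAt (PS α (-lam) 1) (-lam * PS α (-lam) α t) t := by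
    intro t ht
    have h := ((PS_hasDerivAt α (-lam) (1 + α) t hα1 (by linarith) ht).const_mul (-lam)).const_add 1
    rw [show 1 + α - 1 = α by ring] at h
    refine h.congr_of_eventuallyEq ?_
    filter_upwards [Ioi_mem_nhds ht] with s hs
    rw [PS_split α (-lam) 1 s hα1 one_pos hs]; simp
  have hd2 : ∀ t, 0 < t → HasDerivAt (PS α (-lam) 2) (PS α (-lam) 1 t) t := by
    intro t ht
    have h := PS_hasDerivAt α (-lam) 2 t hα1 le_rfl ht
    rwa [show (2 : ℝ) - 1 = 1 by norm_num] at h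
  have hdα : ∀ t, 0 < t → HasDerivAt (PS α (-lam) α) (PS α (-lam) (α - 1) t) t := by
    intro t ht
    have h := (rpow_div_Gamma_hasDerivAt α t hα1 ht).add
      ((PS_hasDerivAt α (-lam) (α + α) t hα1 (by linarith) ht).const_mul (-lam))
    rw [PS_split α (-lam) (α - 1) t hα1 (by linarith) ht, show α - 1 - 1 = α - 2 by ring,
      show α - 1 + α = α + α - 1 by ring]
    refine h.congr_of_eventuallyEq ?_
    filter_upwards [Ioi_mem_nhds ht] with s hs
    rw [PS_split α (-lam) α s hα1 (by linarith) hs]; rfl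
  have hD : ∀ t, 0 < t → deriv (RLint 0 (2 - α) y) t =
      PS α (-lam) 1 t + -lam * PS α (-lam) α t := by
    intro t ht
    refine HasDerivAt.deriv (((hd2 t ht).add (hd1 t ht)).congr_of_eventuallyEq ?_)
    filter_upwards [Ioi_mem_nhds ht] with s hs
    exact hI s hs
  have hlow : ∀ t, 0 < t → RLderivLow 0 (α - 1) y t =
      PS α (-lam) 1 t + -lam * PS α (-lam) α t := by
    intro t ht
    unfold RLderivLow
    rw [show 1 - (α - 1) = 2 - α by ring]
    exact hD t ht
  refine ⟨?_, ?_, ?_⟩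
  · intro t ht
    have : RLderivHigh 0 α y t = -lam * PS α (-lam) α t + -lam * PS α (-lam) (α - 1) t := by
      unfold RLderivHigh
      refine HasDerivAt.deriv (((hd1 t ht.1).add ((hdα t ht.1).const_mul (-lam))).congr_of_eventuallyEq ?_)
      filter_upwards [Ioi_mem_nhds ht.1] with s hs
      exact hD s hs
    rw [this, hyP t ht.1]; ring
  · have h := (PS_tendsto α (-lam) 2 hα1 (by norm_num)).add
      ((PS_tendsto α (-lam) α hα1 hα1).const_mul lam)
    simp only [mul_zero, add_zero] at h
    refine h.congr' ?_
    filter_upwards [self_mem_nhdsWithin] with t ht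
    rw [hI t ht, hlow t ht]; ring
  · rw [hlow 1 one_pos, hy]
    simp only [PS_eq_ML _ _ _ _ one_pos, Real.one_rpow, mul_one, one_mul]
    linarith
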